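/- Let P be a locally finite pocset and let ∼ be an admissible equivalence relation on P. If two classes [ĥ] and [k̂] are transverse in the quotient P/∼, then one of the following holds: (i) there exist representatives h ∈ [h] and k ∈ [k] that are transverse in P; (ii) there exist hyperplanes ĥ₁, ĥ₂ ∈ [ĥ] and k̂₀ ∈ [k̂] such that k̂₀ separates ĥ₁ and ĥ₂; (iii) there exist hyperplanes k̂₁, k̂₂ ∈ [k̂] and ĥ₀ ∈ [ĥ] such that ĥ₀ separates k̂₁ and k̂₂. -/

import Mathlib

/- Pocsets, hyperplanes, admissible equivalence relations, quotients,
   admissible maps, embeddings, resolutions, group actions on pocsets,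
   elementary folds and folding sequences. -/

universe u v w

/-- A pocset: a poset with an order-reversing involution `star` such that
`h ≠ h *` and `h`, `h *` are incomparable. -/
structure Pocset (P : Type u) where
  le : P → P → Prop
  star : P → P
  le_refl : ∀ a, le a a
  le_trans : ∀ {a b c}, le a b → le b c → le a c
  le_antisymm : ∀ {a b}, le a b → le b a → a = b
  star_star : ∀ a, star (star a) = a
  star_antitone : ∀ {a b}, le a b → le (star b) (star a)
  ne_star : ∀ a, a ≠ star a
  not_le_star : ∀ a, ¬ le a (star a)
  not_star_le : ∀ a, ¬ le (star a) a

namespace Pocset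

variable {P : Type u} {P' : Type v}

/-- Strict order. -/
def lt (Q : Pocset P) (a b : P) : Prop := Q.le a b ∧ a ≠ b

/-- The orientations of the hyperplane `ĥ` determined by the halfspace `h`. -/
def orient (Q : Pocset P) (h : P) : Set P := {h, Q.star h}

/-- `k` is an orientation of the same hyperplane as `h`, i.e. `k̂ = ĥ`. -/
def sameHyp (Q : Pocset P) (h k : P) : Prop := k = h ∨ k = Q.star h

/-- The hyperplanes `ĥ` and `k̂` are transverse: they are distinct and no
orientation of `ĥ` is comparable with any orientation of `k̂`. -/
def transverse (Q : Pocset P) (h k : P) : Prop :=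
  ¬ Q.sameHyp h k ∧ ∀ a ∈ Q.orient h, ∀ b ∈ Q.orient k, ¬ Q.le a b ∧ ¬ Q.le b a

/-- Two hyperplanes are disjoint if they are distinct and not transverse. -/
def disjointHyp (Q : Pocset P) (h k : P) : Prop :=
  ¬ Q.sameHyp h k ∧ ¬ Q.transverse h k

/-- The halfspaces `h` and `k` are facing: `h* < k`. -/
def facing (Q : Pocset P) (h k : P) : Prop := Q.lt (Q.star h) k

/-- The halfspaces `h` and `k` are compatible: not `k ≤ h*`. -/
def compatible (Q : Pocset P) (h k : P) : Prop := ¬ Q.le k (Q.star h)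

/-- The hyperplane `k̂` separates the hyperplanes `ĥ` and `l̂`: there are
orientations with `a < b < c`. -/
def separates (Q : Pocset P) (k h l : P) : Prop :=
  ∃ a ∈ Q.orient h, ∃ b ∈ Q.orient k, ∃ c ∈ Q.orient l, Q.lt a b ∧ Q.lt b c

/-- Local finiteness: every interval is finite. -/
def LocallyFinite (Q : Pocset P) : Prop :=
  ∀ a b : P, {c : P | Q.le a c ∧ Q.le c b}.Finite

/-- The equivalence relation induced on hyperplanes by a relation `r` on
halfspaces: `ĥ ∼ k̂` iff `h ∼ k` or `h ∼ k*`. -/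
def hypRel (Q : Pocset P) (r : P → P → Prop) (h k : P) : Prop :=
  r h k ∨ r h (Q.star k)

/-- An admissible equivalence relation on a pocset. -/
structure IsAdmissible (Q : Pocset P) (r : P → P → Prop) : Prop where
  equiv : Equivalence r
  aer1 : ∀ h, ¬ r h (Q.star h)
  aer2 : ∀ h k, r h k → r (Q.star h) (Q.star k)
  aer3 : ∀ h k, Q.transverse h k → ¬ r h k
  aer4 : ∀ h k, Q.hypRel r h k → ¬ Q.sameHyp h k →
    (∀ m, Q.hypRel r h m → ¬ Q.separates m h k) →
    ∀ a ∈ Q.orient h, ∀ b ∈ Q.orient k, Q.facing a b → r a b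

/-- The strict quotient relation: `[h] < [k]` iff `[h] ≠ [k]`, every pair of
representatives has disjoint hyperplanes, and `h' < k'` for every pair of
representatives whose hyperplanes are `([ĥ] ∪ [k̂])`-inseparable. -/
def QuotLT (Q : Pocset P) (r : P → P → Prop) (h k : P) : Prop :=
  ¬ r h k ∧
  (∀ h' k', r h h' → r k k' → Q.disjointHyp h' k') ∧
  (∀ h' k', r h h' → r k k' →
    (∀ m, (Q.hypRel r h m ∨ Q.hypRel r k m) → ¬ Q.separates m h' k') → Q.lt h' k')

/-- The quotient relation: `[h] ≤ [k]` iff `[h] = [k]` or `[h] < [k]`. -/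
def QuotLE (Q : Pocset P) (r : P → P → Prop) (h k : P) : Prop :=
  r h k ∨ Q.QuotLT r h k

/-- Transversality of `[ĥ]` and `[k̂]` in the quotient pocset. -/
def QuotTransverse (Q : Pocset P) (r : P → P → Prop) (h k : P) : Prop :=
  ¬ Q.hypRel r h k ∧
  ∀ a ∈ Q.orient h, ∀ b ∈ Q.orient k, ¬ Q.QuotLE r a b ∧ ¬ Q.QuotLE r b a

/-- `[k̂]` separates `[ĥ]` and `[l̂]` in the quotient pocset. -/
def QuotSeparates (Q : Pocset P) (r : P → P → Prop) (k h l : P) : Prop :=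
  ∃ a ∈ Q.orient h, ∃ b ∈ Q.orient k, ∃ c ∈ Q.orient l,
    Q.QuotLT r a b ∧ Q.QuotLT r b c

/-- `[h]` and `[k]` are facing in the quotient pocset: `[h]* < [k]`. -/
def QuotFacing (Q : Pocset P) (r : P → P → Prop) (h k : P) : Prop :=
  Q.QuotLT r (Q.star h) k

/-- An admissible map of pocsets. -/
structure IsAdmissibleMap (Q : Pocset P) (Q' : Pocset P') (f : P → P') : Prop where
  am1 : ∀ h, f (Q.star h) = Q'.star (f h)
  am2 : ∀ h k, Q.transverse h k → Q'.transverse (f h) (f k)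
  am3 : ∀ h k, Q.facing h k → Q'.sameHyp (f h) (f k) →
    (∀ m, Q'.sameHyp (f m) (f h) → ¬ Q.separates m h k) → f h = f k
  am4 : ∀ h' : P', (∀ m : P, ¬ Q'.sameHyp (f m) h') →
    ∃ b ∈ Q'.orient h', ∀ m : P, Q'.compatible b (f m)

/-- An embedding of pocsets: an injective, order-reflecting admissible map. -/
structure IsPocsetEmbedding (Q : Pocset P) (Q' : Pocset P') (f : P → P') : Prop where
  adm : IsAdmissibleMap Q Q' f
  inj : Function.Injective f
  le_reflect : ∀ h k, Q'.le (f h) (f k) → Q.le h k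

/-- The equivalence relation `∼_f` induced by a map `f`. -/
def simRel (f : P → P') : P → P → Prop := fun a b => f a = f b

/-- A resolution of pocsets: an admissible map `f` such that `∼_f` is an
admissible equivalence relation and the induced map `P/∼_f → P'` is an
embedding of pocsets (stated here on representatives: `quot_am2` and
`quot_am3` are admissibility of the induced map, `le_reflect` is
order-reflection; injectivity of the induced map is automatic, and its
properties (AM1) and (AM4) coincide with those of `f`). -/
structure IsResolution (Q : Pocset P) (Q' : Pocset P') (f : P → P') : Prop where
  adm : IsAdmissibleMap Q Q' f
  aer : Q.IsAdmissible (simRel f)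
  quot_am2 : ∀ h k, Q.QuotTransverse (simRel f) h k → Q'.transverse (f h) (f k)
  quot_am3 : ∀ h k, Q.QuotFacing (simRel f) h k → Q'.sameHyp (f h) (f k) →
    (∀ m, Q'.sameHyp (f m) (f h) → ¬ Q.QuotSeparates (simRel f) m h k) → f h = f k
  le_reflect : ∀ h k, Q'.le (f h) (f k) → Q.QuotLE (simRel f) h k

/-- A group `G` acts (without inversion) on the pocset `Q` by order-preserving
bijections commuting with `star`. -/
structure IsGAction (Q : Pocset P) (G : Type w) [Group G] [MulAction G P] : Prop where
  smul_le : ∀ (g : G) (a b : P), Q.le a b → Q.le (g • a) (g • b)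
  smul_star : ∀ (g : G) (a : P), g • Q.star a = Q.star (g • a)
  no_inversion : ∀ (g : G) (a : P), g • a ≠ Q.star a

/-- `G`-equivariance of a map. -/
def Equivariant (G : Type w) [Group G] [MulAction G P] [MulAction G P']
    (f : P → P') : Prop :=
  ∀ (g : G) (a : P), f (g • a) = g • f a

/-- An elementary foldable pair for a resolution `f`: facing halfspaces with
`f h₁ = f h₂`, whose hyperplanes are `f⁻¹(f(ĥ₁))`-inseparable, such that no
pair of distinct `∼_f`-equivalent hyperplanes both separate `ĥ₁` and `ĥ₂`. -/
def ElemFoldable (Q : Pocset P) (Q' : Pocset P') (f : P → P') (h₁ h₂ : P) : Prop :=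
  Q.facing h₁ h₂ ∧ f h₁ = f h₂ ∧
  (∀ m, Q'.sameHyp (f m) (f h₁) → ¬ Q.separates m h₁ h₂) ∧
  (∀ m m', Q'.sameHyp (f m) (f m') → ¬ Q.sameHyp m m' →
    ¬ (Q.separates m h₁ h₂ ∧ Q.separates m' h₁ h₂))

/-- `r` is the smallest `G`-invariant and `star`-invariant equivalence
relation with `h₁ ∼ h₂`. -/
structure IsFoldRel (Q : Pocset P) (G : Type w) [Group G] [MulAction G P]
    (h₁ h₂ : P) (r : P → P → Prop) : Prop where
  equiv : Equivalence r
  ginv : ∀ (g : G) (a b : P), r a b → r (g • a) (g • b)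
  sinv : ∀ a b, r a b → r (Q.star a) (Q.star b)
  base : r h₁ h₂
  min : ∀ s : P → P → Prop, Equivalence s →
    (∀ (g : G) (a b : P), s a b → s (g • a) (g • b)) →
    (∀ a b, s a b → s (Q.star a) (Q.star b)) → s h₁ h₂ →
    ∀ a b, r a b → s a b

/-- `[h₁]`, `[h₂]` is an elementary foldable pair in the quotient pocset
`P/r` for the resolution induced by `f` on `P/r`. -/
def QuotElemFoldable (Q : Pocset P) (Q' : Pocset P') (f : P → P')
    (r : P → P → Prop) (h₁ h₂ : P) : Prop :=
  Q.QuotFacing r h₁ h₂ ∧ f h₁ = f h₂ ∧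
  (∀ m, Q'.sameHyp (f m) (f h₁) → ¬ Q.QuotSeparates r m h₁ h₂) ∧
  (∀ m m', Q'.sameHyp (f m) (f m') → ¬ Q.hypRel r m m' →
    ¬ (Q.QuotSeparates r m h₁ h₂ ∧ Q.QuotSeparates r m' h₁ h₂))

/-- `r'` is (the pullback to `P` of) the smallest `G`-invariant and
`star`-invariant equivalence relation on `P/r` identifying `[h₁] ∼ [h₂]`,
i.e. the smallest `G`-invariant, `star`-invariant equivalence relation on `P`
containing `r` with `h₁ ∼ h₂`. -/
structure IsFoldStepRel (Q : Pocset P) (G : Type w) [Group G] [MulAction G P]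
    (r : P → P → Prop) (h₁ h₂ : P) (r' : P → P → Prop) : Prop where
  equiv : Equivalence r'
  mono : ∀ a b, r a b → r' a b
  ginv : ∀ (g : G) (a b : P), r' a b → r' (g • a) (g • b)
  sinv : ∀ a b, r' a b → r' (Q.star a) (Q.star b)
  base : r' h₁ h₂
  min : ∀ s : P → P → Prop, Equivalence s → (∀ a b, r a b → s a b) →
    (∀ (g : G) (a b : P), s a b → s (g • a) (g • b)) →
    (∀ a b, s a b → s (Q.star a) (Q.star b)) → s h₁ h₂ →
    ∀ a b, r' a b → s a b

/-- A finite folding sequence `P = P₀ ↝ P₁ ↝ ⋯ ↝ Pₙ` for a `G`-equivariant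
resolution `f : P → P'`, encoded by the sequence of equivalence relations
`rs i` on `P` with `Pᵢ = P / rs i`: `rs 0` is equality, every `rs i` refines
`∼_f`, and each step is an elementary fold (of an elementary foldable pair
for the induced resolution `fᵢ : P/rs i → P'`). -/
def IsFoldingSequence (Q : Pocset P) (Q' : Pocset P') (G : Type w) [Group G]
    [MulAction G P] (f : P → P') (n : ℕ)
    (rs : Fin (n + 1) → (P → P → Prop)) : Prop :=
  (∀ a b : P, rs 0 a b ↔ a = b) ∧
  (∀ (i : Fin (n + 1)) (a b : P), rs i a b → f a = f b) ∧
  (∀ i : Fin n, ∃ h₁ h₂ : P,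
    Q.QuotElemFoldable Q' f (rs i.castSucc) h₁ h₂ ∧
    Q.IsFoldStepRel G (rs i.castSucc) h₁ h₂ (rs i.succ))

end Pocset

namespace Pocset

variable {P : Type u} {Q : Pocset P}

theorem lt_trans {a b c : P} (hab : Q.lt a b) (hbc : Q.lt b c) : Q.lt a c := by
  refine ⟨Q.le_trans hab.1 hbc.1, ?_⟩
  rintro rfl
  exact hab.2 (Q.le_antisymm hab.1 hbc.1)

theorem not_lt_self (a : P) : ¬ Q.lt a a := fun h => h.2 rfl

theorem lt_star_star {a b : P} (hab : Q.lt a b) : Q.lt (Q.star b) (Q.star a) := by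
  refine ⟨Q.star_antitone hab.1, fun e => hab.2 ?_⟩
  rw [← Q.star_star a, ← e, Q.star_star]

theorem star_lt_comm {a b : P} (hab : Q.lt (Q.star a) b) : Q.lt (Q.star b) a := by
  simpa only [Q.star_star] using lt_star_star hab

theorem lt_star_comm {a b : P} (hab : Q.lt a (Q.star b)) : Q.lt b (Q.star a) := by
  simpa only [Q.star_star] using lt_star_star hab

theorem mem_orient {a x : P} : a ∈ Q.orient x ↔ a = x ∨ a = Q.star x := Iff.rfl

/-- No hyperplane has orientations below both orientations of another hyperplane. -/
theorem not_lt_of_mem_orient {x a a' b : P} (ha : a ∈ Q.orient x) (ha' : a' ∈ Q.orient x)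
    (hab : Q.lt a b) : ¬ Q.lt a' (Q.star b) := by
  intro h'
  have key : a' = a ∨ a' = Q.star a := by
    rw [mem_orient] at ha ha'
    have := Q.star_star x
    rcases ha with rfl | rfl <;> rcases ha' with rfl | rfl <;> simp_all
  rcases key with rfl | rfl
  · exact Q.not_le_star _ (lt_trans hab (lt_star_comm h')).1
  · exact not_lt_self _ (lt_trans hab (by simpa only [Q.star_star] using lt_star_star h'))

/-- A hyperplane separating the hyperplanes of `x < y` has an orientation between `x` and `y`. -/
theorem separates.exists_between {m x y : P} (hm : Q.separates m x y) (hxy : Q.lt x y) :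
    ∃ m' ∈ Q.orient m, Q.lt x m' ∧ Q.lt m' y := by
  obtain ⟨a, ha, b, hb, c, hc, hab, hbc⟩ := hm
  have hac := lt_trans hab hbc
  rw [mem_orient] at hc
  rcases hc with rfl | rfl
  · rcases ha with rfl | rfl
    · exact ⟨b, hb, hab, hbc⟩
    · exact absurd (lt_trans (star_lt_comm hac) hxy).1 (Q.not_star_le _)
  · exact absurd hac (not_lt_of_mem_orient (Or.inl rfl) ha hxy)

theorem mem_orient_star {a x : P} : a ∈ Q.orient (Q.star x) ↔ a ∈ Q.orient x := by
  simp only [mem_orient, Q.star_star]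
  exact or_comm

/-- Two hyperplanes that are neither equal nor transverse have comparable orientations. -/
theorem exists_lt_of_not_transverse {x y : P} (hne : ¬ Q.sameHyp x y)
    (ht : ¬ Q.transverse x y) : ∃ a ∈ Q.orient x, Q.lt a y ∨ Q.lt a (Q.star y) := by
  have hs := Q.star_star
  have hcomp : ∃ a ∈ Q.orient x, ∃ b ∈ Q.orient y, Q.le a b ∨ Q.le b a := by
    by_contra hcon
    push Not at hcon
    exact ht ⟨hne, hcon⟩
  obtain ⟨a, ha, b, hb, hab⟩ := hcomp
  have hab' : a ≠ b := by
    rintro rfl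
    apply hne
    rw [mem_orient] at ha hb
    unfold sameHyp
    rcases ha with rfl | rfl <;> rcases hb with hb | hb <;> simp_all
    exact Or.inl (by rw [← hs y, ← hb, hs])
  have hlt : ∃ a ∈ Q.orient x, ∃ b ∈ Q.orient y, Q.lt a b := by
    rcases hab with hab | hab
    · exact ⟨a, ha, b, hb, hab, hab'⟩
    · refine ⟨Q.star a, ?_, Q.star b, ?_, lt_star_star ⟨hab, hab'.symm⟩⟩
      · rcases ha with rfl | rfl <;> simp [mem_orient, hs]
      · rcases hb with rfl | rfl <;> simp [mem_orient, hs]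
  obtain ⟨a, ha, b, hb, hab⟩ := hlt
  rcases hb with rfl | rfl
  · exact ⟨a, ha, Or.inl hab⟩
  · exact ⟨a, ha, Or.inr hab⟩

theorem IsAdmissible.star_iff {r : P → P → Prop} (hr : Q.IsAdmissible r) {x y : P} :
    r (Q.star x) y ↔ r x (Q.star y) := by
  constructor <;> intro h <;> simpa only [Q.star_star] using hr.aer2 _ _ h

theorem hypRel_star {r : P → P → Prop} {x y : P} :
    Q.hypRel r x (Q.star y) ↔ Q.hypRel r x y := by
  simp only [hypRel, Q.star_star]
  exact or_comm

theorem IsAdmissible.hypRel_symm {r : P → P → Prop} (hr : Q.IsAdmissible r) {x y : P}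
    (h : Q.hypRel r x y) : Q.hypRel r y x := by
  rcases h with h | h
  · exact Or.inl (hr.equiv.symm h)
  · exact Or.inr (hr.star_iff.1 (hr.equiv.symm h))

theorem IsAdmissible.hypRel_trans {r : P → P → Prop} (hr : Q.IsAdmissible r) {x y z : P}
    (h : Q.hypRel r x y) (h' : Q.hypRel r y z) : Q.hypRel r x z := by
  rcases h with h | h
  · exact h'.imp (hr.equiv.trans h) (hr.equiv.trans h)
  · rcases h' with h' | h'
    · exact Or.inr (hr.equiv.trans h (hr.aer2 _ _ h'))
    · exact Or.inl (hr.equiv.trans h (hr.star_iff.2 h'))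

theorem hypRel_orient {r : P → P → Prop} {x y a : P}
    (h : Q.hypRel r x y) (ha : a ∈ Q.orient y) : Q.hypRel r x a := by
  rcases ha with rfl | rfl
  · exact h
  · exact hypRel_star.2 h

theorem transverse_star {x y : P} (h : Q.transverse x y) : Q.transverse x (Q.star y) := by
  refine ⟨fun e => h.1 ?_, fun a ha b hb => h.2 a ha b (mem_orient_star.1 hb)⟩
  have := Q.star_star y
  rcases e with e | e
  · exact Or.inr (by rw [← e, this])
  · exact Or.inl (by rw [← this, e, Q.star_star])

theorem transverse_symm {x y : P} (h : Q.transverse x y) : Q.transverse y x := by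
  refine ⟨fun e => h.1 ?_, fun a ha b hb => (h.2 b hb a ha).symm⟩
  rcases e with rfl | rfl
  · exact Or.inl rfl
  · exact Or.inr (Q.star_star _).symm

theorem IsAdmissible.not_transverse {r : P → P → Prop} (hr : Q.IsAdmissible r) {x y : P}
    (h : Q.hypRel r x y) : ¬ Q.transverse x y := fun ht =>
  h.elim (hr.aer3 _ _ ht) (hr.aer3 _ _ (transverse_star ht))

/-- If no hyperplane of `[k̂]` separates two hyperplanes of `[ĥ]`, then all of `[ĥ]` lies on the
same side of each hyperplane of `[k̂]`. -/
theorem exists_lt_of_not_separates {r : P → P → Prop} {h k : P}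
    (hd : ∀ x y, Q.hypRel r h x → Q.hypRel r k y → ¬ Q.sameHyp x y ∧ ¬ Q.transverse x y)
    (hs : ∀ x y m, Q.hypRel r h x → Q.hypRel r h y → Q.hypRel r k m → ¬ Q.separates m x y)
    {x y a b : P} (hx : Q.hypRel r h x) (hy : Q.hypRel r h y) (hb : Q.hypRel r k b)
    (ha : a ∈ Q.orient x) (hab : Q.lt a b) : ∃ c ∈ Q.orient y, Q.lt c b := by
  obtain ⟨c, hc, hcb | hcb⟩ := exists_lt_of_not_transverse (hd y b hy hb).1 (hd y b hy hb).2
  · exact ⟨c, hc, hcb⟩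
  · refine absurd ⟨a, ha, b, Or.inl rfl, Q.star c, ?_, hab, lt_star_comm hcb⟩ (hs x y b hx hy hb)
    rcases hc with rfl | rfl <;> simp [mem_orient, Q.star_star]

/-- Halfspaces of `[k̂]` containing all of `[ĥ]`, and not separated by `[k̂]` from some hyperplane
of `[ĥ]`, are equivalent. -/
theorem IsAdmissible.rel_of_lt {r : P → P → Prop} (hr : Q.IsAdmissible r) {h k : P}
    (hd : ∀ x y, Q.hypRel r h x → Q.hypRel r k y → ¬ Q.sameHyp x y ∧ ¬ Q.transverse x y)
    (hs : ∀ x y m, Q.hypRel r h x → Q.hypRel r h y → Q.hypRel r k m → ¬ Q.separates m x y)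
    {a a' b b' : P} (ha : Q.hypRel r h a) (ha' : Q.hypRel r h a') (hb : Q.hypRel r k b)
    (hb' : Q.hypRel r k b') (hab : Q.lt a b) (hab' : Q.lt a' b')
    (hsep : ∀ m, Q.hypRel r k m → ¬ Q.separates m a b)
    (hsep' : ∀ m, Q.hypRel r k m → ¬ Q.separates m a' b') : r b b' := by
  -- a halfspace of `[k̂]` strictly below `b` or `b'` contains none of `[ĥ]`
  have aux : ∀ {a a' b c : P}, Q.hypRel r h a → Q.hypRel r h a' → Q.hypRel r k c →
      (∀ m, Q.hypRel r k m → ¬ Q.separates m a b) → Q.lt c b → ¬ Q.lt a' c := by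
    intro a a' b c ha ha' hc hsep hcb hac
    obtain ⟨d, hd', hdc⟩ := exists_lt_of_not_separates hd hs ha' ha hc (Or.inl rfl) hac
    exact hsep c hc ⟨d, hd', c, Or.inl rfl, b, Or.inl rfl, hdc, hcb⟩
  have hbb := hr.hypRel_trans (hr.hypRel_symm hb) hb'
  obtain ⟨c, hc, hcb'⟩ := exists_lt_of_not_separates hd hs ha' ha hb' (Or.inl rfl) hab'
  by_cases hsame : Q.sameHyp b b'
  · rcases hsame with rfl | rfl
    · exact hr.equiv.refl _
    · exact absurd hcb' (not_lt_of_mem_orient (Or.inl rfl) hc hab)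
  have hfac : Q.lt (Q.star b) b' := by
    obtain ⟨d, hd', hdb⟩ := exists_lt_of_not_transverse hsame (hr.not_transverse hbb)
    rcases hd' with rfl | rfl
    · rcases hdb with hdb | hdb
      · exact absurd hab (aux ha' ha hb hsep' hdb)
      · exact absurd (lt_trans hab hdb) (not_lt_of_mem_orient hc (Or.inl rfl) hcb')
    · rcases hdb with hdb | hdb
      · exact hdb
      · have : Q.lt b' b := by simpa only [Q.star_star] using lt_star_star hdb
        exact absurd hab' (aux ha ha' hb' hsep this)
  refine hr.aer4 b b' hbb hsame ?_ b (Or.inl rfl) b' (Or.inl rfl) hfac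
  intro m hm hmsep
  have hmk := hr.hypRel_trans hb hm
  have hmsep' : Q.separates m (Q.star b) b' := by
    obtain ⟨x, hx, H⟩ := hmsep
    exact ⟨x, mem_orient_star.2 hx, H⟩
  obtain ⟨c, hc, hbc, hcb⟩ := hmsep'.exists_between hfac
  have hck := hypRel_orient hmk hc
  obtain ⟨d, hd', hdc | hdc⟩ := exists_lt_of_not_transverse (hd a c ha hck).1 (hd a c ha hck).2
  · exact aux ha' (hypRel_orient ha hd') hck hsep' hcb hdc
  · exact aux ha (hypRel_orient ha hd') (hypRel_star.2 hck) hsep (star_lt_comm hbc) hdc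

/-- A nonempty finite set of halfspaces has a maximal element. -/
theorem exists_maximal {s : Set P} (hs : s.Finite) (hne : s.Nonempty) (Q : Pocset P) :
    ∃ x ∈ s, ∀ y ∈ s, ¬ Q.lt x y := by
  let _ : PartialOrder P :=
    { le := Q.le
      le_refl := Q.le_refl
      le_trans := fun _ _ _ => Q.le_trans
      le_antisymm := fun _ _ => Q.le_antisymm }
  obtain ⟨x, hx⟩ := hs.exists_maximal hne
  exact ⟨x, hx.1, fun y hy hxy => hxy.2 (Q.le_antisymm hxy.1 (hx.2 hy hxy.1))⟩

/-- Between two halfspaces from predicates `A` and `B` there is an innermost such pair. -/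
theorem exists_innermost (hLF : Q.LocallyFinite) {A B : P → Prop} {a b : P} (ha : A a) (hb : B b)
    (hab : Q.lt a b) : ∃ x y, A x ∧ B y ∧ Q.lt x y ∧
      ∀ m, A m ∨ B m → ¬ (Q.lt x m ∧ Q.lt m y) := by
  obtain ⟨x, hx, hxmax⟩ := exists_maximal (s := {x | A x ∧ Q.le a x ∧ Q.lt x b})
    ((hLF a b).subset fun x hx => ⟨hx.2.1, hx.2.2.1⟩) ⟨a, ha, Q.le_refl a, hab⟩ Q
  obtain ⟨z, ⟨y, hy, rfl⟩, hzmax⟩ := exists_maximal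
    (s := Q.star '' {y | B y ∧ Q.lt x y ∧ Q.le y b})
    (((hLF x b).subset fun y hy => ⟨hy.2.1.1, hy.2.2⟩).image _)
    ⟨_, b, ⟨hb, hx.2.2, Q.le_refl b⟩, rfl⟩ Q
  refine ⟨x, y, hx.1, hy.1, hy.2.1, ?_⟩
  rintro m (hm | hm) ⟨hxm, hmy⟩
  · refine hxmax m ⟨hm, Q.le_trans hx.2.1 hxm.1, Q.le_trans hmy.1 hy.2.2, ?_⟩ hxm
    rintro rfl
    exact hmy.2 (Q.le_antisymm hmy.1 hy.2.2)
  · exact hzmax _ ⟨m, ⟨hm, hxm, Q.le_trans hmy.1 hy.2.2⟩, rfl⟩ (lt_star_star hmy)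

theorem separates_symm {m x y : P} (h : Q.separates m x y) : Q.separates m y x := by
  obtain ⟨a, ha, b, hb, c, hc, hab, hbc⟩ := h
  have hst : ∀ {u v : P}, u ∈ Q.orient v → Q.star u ∈ Q.orient v := by
    intro u v hu
    rcases hu with rfl | rfl <;> simp [mem_orient, Q.star_star]
  exact ⟨_, hst hc, _, hst hb, _, hst ha, lt_star_star hbc, lt_star_star hab⟩

theorem separates_star_star {m x y : P} (h : Q.separates m (Q.star x) (Q.star y)) :
    Q.separates m x y := by
  obtain ⟨a, ha, b, hb, c, hc, hab, hbc⟩ := h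
  exact ⟨a, mem_orient_star.1 ha, b, hb, c, mem_orient_star.1 hc, hab, hbc⟩

/-- If all hyperplanes of `[ĥ]` and `[k̂]` are disjoint and neither class has a hyperplane
separating two of the other, then an inseparable pair `a < b` descends to `[a] < [b]`. -/
theorem IsAdmissible.quotLT_of_lt {r : P → P → Prop} (hr : Q.IsAdmissible r) {h k : P}
    (hhk : ¬ Q.hypRel r h k)
    (hd : ∀ x y, Q.hypRel r h x → Q.hypRel r k y → ¬ Q.sameHyp x y ∧ ¬ Q.transverse x y)
    (hs : ∀ x y m, Q.hypRel r h x → Q.hypRel r h y → Q.hypRel r k m → ¬ Q.separates m x y)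
    (hs' : ∀ x y m, Q.hypRel r k x → Q.hypRel r k y → Q.hypRel r h m → ¬ Q.separates m x y)
    {a b : P} (ha : r h a) (hb : r k b) (hab : Q.lt a b)
    (hsep : ∀ m, (Q.hypRel r h m ∨ Q.hypRel r k m) → ¬ Q.separates m a b) :
    Q.QuotLT r h k := by
  refine ⟨fun e => hhk (Or.inl e), fun x y hx hy => hd x y (Or.inl hx) (Or.inl hy), ?_⟩
  intro x y hx hy hxy
  have hd' : ∀ x y, Q.hypRel r k x → Q.hypRel r h y → ¬ Q.sameHyp x y ∧ ¬ Q.transverse x y := by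
    intro x y hx hy
    refine ⟨fun e => (hd y x hy hx).1 ?_, fun e => (hd y x hy hx).2 (transverse_symm e)⟩
    rcases e with rfl | rfl
    · exact Or.inl rfl
    · exact Or.inr (Q.star_star _).symm
  have hsepx : ∀ {c d : P}, c ∈ Q.orient x → d ∈ Q.orient y →
      ∀ m, (Q.hypRel r h m ∨ Q.hypRel r k m) → ¬ Q.separates m c d := by
    rintro c d hc hd m hm ⟨u, hu, v, hv, w, hw, huv, hvw⟩
    refine hxy m hm ⟨u, ?_, v, hv, w, ?_, huv, hvw⟩
    · rcases hc with rfl | rfl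
      exacts [hu, mem_orient_star.1 hu]
    · rcases hd with rfl | rfl
      exacts [hw, mem_orient_star.1 hw]
  have main : ∀ {c d : P}, c ∈ Q.orient x → d ∈ Q.orient y → Q.lt c d → r b d ∧ r a c := by
    intro c d hc hd'' hcd
    have hch : Q.hypRel r h c := hypRel_orient (Or.inl hx) hc
    have hdk : Q.hypRel r k d := hypRel_orient (Or.inl hy) hd''
    have hsepcd := hsepx hc hd''
    refine ⟨hr.rel_of_lt hd hs (Or.inl ha) hch (Or.inl hb) hdk hab hcd
      (fun m hm => hsep m (Or.inr hm)) (fun m hm => hsepcd m (Or.inr hm)), ?_⟩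
    have := hr.rel_of_lt hd' hs' (hypRel_star.2 (Or.inl hb)) (hypRel_star.2 hdk)
      (hypRel_star.2 (Or.inl ha)) (hypRel_star.2 hch) (lt_star_star hab) (lt_star_star hcd)
      (fun m hm e => hsep m (Or.inl hm) (separates_symm (separates_star_star e)))
      (fun m hm e => hsepcd m (Or.inl hm) (separates_symm (separates_star_star e)))
    simpa only [Q.star_star] using hr.star_iff.1 this
  have hax : r a x := hr.equiv.trans (hr.equiv.symm ha) hx
  have hby : r b y := hr.equiv.trans (hr.equiv.symm hb) hy
  have hdxy := hd x y (Or.inl hx) (Or.inl hy)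
  have hcd : ∃ c ∈ Q.orient x, ∃ d ∈ Q.orient y, Q.lt c d := by
    obtain ⟨c, hc, hcy | hcy⟩ := exists_lt_of_not_transverse hdxy.1 hdxy.2
    exacts [⟨c, hc, y, Or.inl rfl, hcy⟩, ⟨c, hc, _, Or.inr rfl, hcy⟩]
  obtain ⟨c, hc, d, hd'', hcd⟩ := hcd
  obtain ⟨hbd, hac⟩ := main hc hd'' hcd
  rcases hc with rfl | rfl
  · rcases hd'' with rfl | rfl
    · exact hcd
    · exact absurd (hr.equiv.trans (hr.equiv.symm hby) hbd) (hr.aer1 y)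
  · exact absurd (hr.equiv.trans (hr.equiv.symm hax) hac) (hr.aer1 x)

end Pocset

/-- if `[ĥ]` and `[k̂]` are transverse in the quotient then
either some representatives are transverse, or some representative of one
class separates two representatives of the other. -/
theorem preimage_of_crossing_hyperplanes {P : Type u} (Q : Pocset P)
    (hLF : Q.LocallyFinite) (r : P → P → Prop) (hr : Q.IsAdmissible r)
    (h k : P) (ht : Q.QuotTransverse r h k) :
    (∃ h' k' : P, r h h' ∧ r k k' ∧ Q.transverse h' k') ∨
    (∃ h₁ h₂ k₀ : P, Q.hypRel r h h₁ ∧ Q.hypRel r h h₂ ∧ Q.hypRel r k k₀ ∧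
      Q.separates k₀ h₁ h₂) ∨
    (∃ k₁ k₂ h₀ : P, Q.hypRel r k k₁ ∧ Q.hypRel r k k₂ ∧ Q.hypRel r h h₀ ∧
      Q.separates h₀ k₁ k₂) := by
  by_contra! hcon
  obtain ⟨h1, h2, h3⟩ := hcon
  have hd : ∀ x y, Q.hypRel r h x → Q.hypRel r k y →
      ¬ Q.sameHyp x y ∧ ¬ Q.transverse x y := by
    intro x y hx hy
    refine ⟨fun e => ht.1 ?_, fun e => ?_⟩
    · exact hr.hypRel_trans (Pocset.hypRel_orient hx e) (hr.hypRel_symm hy)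
    · have e' := Pocset.transverse_symm (Pocset.transverse_star (Pocset.transverse_symm e))
      rcases hx with hx | hx <;> rcases hy with hy | hy
      · exact h1 _ _ hx hy e
      · exact h1 _ _ hx hy (Pocset.transverse_star e)
      · exact h1 _ _ hx hy e'
      · exact h1 _ _ hx hy (Pocset.transverse_star e')
  have hh : Q.hypRel r h h := Or.inl (hr.equiv.refl h)
  have hk : Q.hypRel r k k := Or.inl (hr.equiv.refl k)
  have hlt : ∃ a b, Q.hypRel r h a ∧ Q.hypRel r k b ∧ Q.lt a b := by
    obtain ⟨a, ha, hak | hak⟩ := Pocset.exists_lt_of_not_transverse (hd h k hh hk).1 (hd h k hh hk).2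
    · exact ⟨a, k, Pocset.hypRel_orient hh ha, hk, hak⟩
    · exact ⟨a, _, Pocset.hypRel_orient hh ha,
        Pocset.hypRel_star.2 hk, hak⟩
  obtain ⟨a₀, b₀, ha₀, hb₀, hab₀⟩ := hlt
  obtain ⟨a, b, ha, hb, hab, hin⟩ := Pocset.exists_innermost hLF ha₀ hb₀ hab₀
  have hsep : ∀ m, (Q.hypRel r h m ∨ Q.hypRel r k m) → ¬ Q.separates m a b := by
    intro m hm hms
    obtain ⟨m', hm', hmm⟩ := hms.exists_between hab
    exact hin m' (hm.imp (fun e => Pocset.hypRel_orient e hm')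
      (fun e => Pocset.hypRel_orient e hm')) hmm
  have horient : ∀ {x c : P}, Q.hypRel r x c → ∃ x' ∈ Q.orient x, r x' c ∧
      ∀ m, Q.hypRel r x' m ↔ Q.hypRel r x m := by
    rintro x c (e | e)
    · exact ⟨x, Or.inl rfl, e, fun m => Iff.rfl⟩
    · refine ⟨Q.star x, Or.inr rfl, hr.star_iff.2 e, fun m => ?_⟩
      have : Q.hypRel r x (Q.star x) := Or.inr (by rw [Q.star_star]; exact hr.equiv.refl x)
      exact ⟨hr.hypRel_trans this, hr.hypRel_trans (hr.hypRel_symm this)⟩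
  obtain ⟨h', hh', hha, hhm⟩ := horient ha
  obtain ⟨k', hk', hkb, hkm⟩ := horient hb
  refine (ht.2 h' hh' k' hk').1 (Or.inr (hr.quotLT_of_lt ?_ ?_ ?_ ?_ hha hkb hab ?_))
  · rw [hhm]
    intro e
    apply ht.1
    rcases hk' with rfl | rfl
    exacts [e, Pocset.hypRel_star.1 e]
  all_goals simpa only [hhm, hkm]
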